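/- Let μ and ν be integrable unconditional measures on ℝⁿ, each concentrated on A_{[n]} = {x ∈ ℝⁿ : x_i ≠ 0 for all i}. Then μ⊛ν ≠ 0 if and only if μ ≠ 0 and ν ≠ 0. -/

import Mathlib

open MeasureTheory
open scoped ENNReal symmDiff Classical

noncomputable section

/-- The Euclidean (ℓ²) norm on `Fin n → ℝ`. -/
def e2 {n : ℕ} (x : Fin n → ℝ) : ℝ := Real.sqrt (∑ i, (x i) ^ 2)

/-- The unit sphere `S^{n-1}` in `ℝⁿ`. -/
def Sph (n : ℕ) : Set (Fin n → ℝ) := {x | e2 x = 1}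

/-- The set `A_E = {x : xᵢ ≠ 0 ↔ i ∈ E}`. -/
def setA {n : ℕ} (E : Finset (Fin n)) : Set (Fin n → ℝ) := {x | ∀ i, x i ≠ 0 ↔ i ∈ E}

/-- Finite signed Borel measures on `ℝⁿ`. -/
abbrev SM (n : ℕ) := MeasureTheory.SignedMeasure (Fin n → ℝ)

/-- A (finite) measure regarded as a signed measure (junk value `0` if not finite). -/
def toSigned {X : Type*} [MeasurableSpace X] (ρ : Measure X) : SignedMeasure X :=
  if h : IsFiniteMeasure ρ then @Measure.toSignedMeasure X _ ρ h else 0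

/-- Multiplicative convolution of two non-negative measures. -/
def mconvPos {n : ℕ} (ρ σ : Measure (Fin n → ℝ)) : Measure (Fin n → ℝ) :=
  (ρ.prod σ).map (fun p => p.1 * p.2)

/-- Multiplicative convolution `μ ⊛ ν` of two signed measures, via Jordan decomposition. -/
def mconv {n : ℕ} (μ ν : SM n) : SM n :=
  toSigned (mconvPos μ.toJordanDecomposition.posPart ν.toJordanDecomposition.posPart
      + mconvPos μ.toJordanDecomposition.negPart ν.toJordanDecomposition.negPart)
  - toSigned (mconvPos μ.toJordanDecomposition.posPart ν.toJordanDecomposition.negPart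
      + mconvPos μ.toJordanDecomposition.negPart ν.toJordanDecomposition.posPart)

/-- `μ` is integrable: `∫ ‖x‖₂ d|μ| < ∞`. -/
def IntegrableSM {n : ℕ} (μ : SM n) : Prop :=
  ∫⁻ x, ENNReal.ofReal (e2 x) ∂μ.totalVariation < ⊤

/-- `μ` is concentrated on `A`:  `|μ|(Aᶜ) = 0`. -/
def ConcOn {n : ℕ} (μ : SM n) (A : Set (Fin n → ℝ)) : Prop := μ.totalVariation Aᶜ = 0

/-- The multiple reflection `T_E` on `ℝⁿ`. -/
def flipE {n : ℕ} (E : Finset (Fin n)) (x : Fin n → ℝ) : Fin n → ℝ :=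
  fun i => if i ∈ E then -x i else x i

/-- Pushforward of a signed measure under `T_E`. -/
def Tmap {n : ℕ} (E : Finset (Fin n)) (μ : SM n) : SM n := μ.map (flipE E)

def EvenUnder {n : ℕ} (μ : SM n) (E : Finset (Fin n)) : Prop := Tmap E μ = μ
def OddUnder {n : ℕ} (μ : SM n) (E : Finset (Fin n)) : Prop := Tmap E μ = -μ

/-- Orthogonal projection onto the coordinate subspace `H_E`. -/
def projE {n : ℕ} (E : Finset (Fin n)) (x : Fin n → ℝ) : Fin n → ℝ :=
  fun i => if i ∈ E then x i else 0

/-- `P_E(μ)`: pushforward under `projE`. -/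
def Pmap {n : ℕ} (E : Finset (Fin n)) (μ : SM n) : SM n := μ.map (projE E)

/-- `R_E(μ) = μ_E`: restriction to `A_E`. -/
def Rres {n : ℕ} (E : Finset (Fin n)) (μ : SM n) : SM n := μ.restrict (setA E)

/-- Sign vector attached to `b : Fin n → Bool`. -/
def signVec {n : ℕ} (b : Fin n → Bool) : Fin n → ℝ := fun i => if b i then 1 else -1

/-- The measure `δ_J = 2^{-n} ∑_{s ∈ 𝒮ⁿ} σ_J(s) δ_s`. -/
def deltaJ {n : ℕ} (J : Finset (Fin n)) : SM n :=
  ((2 : ℝ) ^ n)⁻¹ •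
    ∑ b : Fin n → Bool,
      (∏ j ∈ J, (if b j then (1 : ℝ) else -1)) • toSigned (Measure.dirac (signVec b))

/-- `𝒥(E; Fe, Fo)`. -/
def JsetE {n : ℕ} (E : Finset (Fin n)) (Fe Fo : Set (Finset (Fin n))) :
    Set (Finset (Fin n)) :=
  {J | J ⊆ E ∧ (∀ F ∈ Fe, Even (J ∩ F).card) ∧ (∀ F ∈ Fo, Odd (J ∩ F).card)}

/-- `𝒥(Fe, Fo) = 𝒥([n]; Fe, Fo)`. -/
def Jset {n : ℕ} (Fe Fo : Set (Finset (Fin n))) : Set (Finset (Fin n)) :=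
  {J | (∀ F ∈ Fe, Even (J ∩ F).card) ∧ (∀ F ∈ Fo, Odd (J ∩ F).card)}

/-- `G` has a representation `G = F₁ Δ … Δ F_m` with each `Fᵢ` drawn from `Fe` or `Fo`,
in which the number of terms drawn from `Fo` is even (`odd = false`) or odd (`odd = true`). -/
def HasRep {n : ℕ} (Fe Fo : Set (Finset (Fin n))) (G : Finset (Fin n)) (odd : Bool) : Prop :=
  ∃ l : List (Finset (Fin n) × Bool),
    (∀ p ∈ l, if p.2 then p.1 ∈ Fo else p.1 ∈ Fe) ∧
    (l.map Prod.fst).foldr (· ∆ ·) ∅ = G ∧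
    (l.countP (fun p => p.2)) % 2 = (if odd then 1 else 0)

/-- The generating pair `(Fe, Fo)` is proper: the even and odd parts of the generated group
are disjoint. -/
def ProperPair {n : ℕ} (Fe Fo : Set (Finset (Fin n))) : Prop :=
  ∀ G : Finset (Fin n), ¬ (HasRep Fe Fo G false ∧ HasRep Fe Fo G true)

/-- `ℳ^int(A; Fe, Fo)`: integrable signed measures concentrated on `A`, even under `T_F`
for `F ∈ Fe` and odd under `T_F` for `F ∈ Fo`. -/
def MclassInt {n : ℕ} (A : Set (Fin n → ℝ)) (Fe Fo : Set (Finset (Fin n))) : Set (SM n) :=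
  {μ | IntegrableSM μ ∧ ConcOn μ A ∧ (∀ F ∈ Fe, EvenUnder μ F) ∧ (∀ F ∈ Fo, OddUnder μ F)}

/-- `ν` is universal on `𝒜`. -/
def Universal {n : ℕ} (ν : SM n) (𝒜 : Set (SM n)) : Prop :=
  ∀ μ ∈ 𝒜, mconv ν μ = 0 → μ = 0

/-- Radial projection of a non-negative measure. -/
def radPos {n : ℕ} (ρ : Measure (Fin n → ℝ)) : Measure (Fin n → ℝ) :=
  (ρ.withDensity fun x => ENNReal.ofReal (e2 x)).map (fun x => (e2 x)⁻¹ • x)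

/-- Radial projection `P_S` of a signed measure. -/
def PS {n : ℕ} (μ : SM n) : SM n :=
  toSigned (radPos μ.toJordanDecomposition.posPart) -
    toSigned (radPos μ.toJordanDecomposition.negPart)

/-- The spherical product `μ ⊛_S ν = P_S(μ ⊛ ν)`. -/
def mconvS {n : ℕ} (μ ν : SM n) : SM n := PS (mconv μ ν)

/-- `ν` is spherically universal on `𝒜`. -/
def SphUniversal {n : ℕ} (ν : SM n) (𝒜 : Set (SM n)) : Prop :=
  ∀ μ ∈ 𝒜, mconvS ν μ = 0 → μ = 0

/-- The unconditional symmetrisation `M_unc`. -/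
def Munc {n : ℕ} (μ : SM n) : SM n := ((2 : ℝ) ^ n)⁻¹ • ∑ E : Finset (Fin n), Tmap E μ

/-- Integral of `f` against a signed measure. -/
def sInt {n : ℕ} (μ : SM n) (f : (Fin n → ℝ) → ℝ) : ℝ :=
  (∫ x, f x ∂μ.toJordanDecomposition.posPart) - ∫ x, f x ∂μ.toJordanDecomposition.negPart

/-- `δ₁ ⊗ μ`: the lifting of `μ` to a measure on `ℝ^{n+1}`, with an extra `0`-th coordinate
carrying a unit atom at `1`. -/
def lift0 {n : ℕ} (μ : SM n) : SM (n + 1) := μ.map (fun x => Fin.cons 1 x)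

/-- Symmetrisation about the origin. -/
def Msym {n : ℕ} (μ : SM n) : SM n := (2 : ℝ)⁻¹ • (μ + μ.map (fun x => -x))

/-- The lifting `L(μ) = P_S(M_sym(δ₁ ⊗ μ))`. -/
def Lift {n : ℕ} (μ : SM n) : SM (n + 1) := PS (Msym (lift0 μ))


section Laplace

open scoped RealInnerProductSpace

variable {V : Type*} [NormedAddCommGroup V] [InnerProductSpace ℝ V]

/-- The exponential character of `V` with frequency `a + i t + w d`. -/
def expChar (a t d : V) (w : ℂ) (x : V) : ℂ :=
  Complex.exp ((⟪x, a⟫ : ℂ) + ⟪x, t⟫ * Complex.I + w * ⟪x, d⟫)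

lemma expChar_add (a t d : V) (w : ℂ) (x y : V) :
    expChar a t d w (x + y) = expChar a t d w x * expChar a t d w y := by
  simp only [expChar, ← Complex.exp_add, inner_add_left]
  congr 1
  push_cast
  ring

lemma norm_expChar (a t d : V) (w : ℂ) (x : V) :
    ‖expChar a t d w x‖ = Real.exp ⟪x, a + w.re • d⟫ := by
  simp [expChar, Complex.norm_exp, inner_add_right, inner_smul_right]

lemma hasDerivAt_expChar (a t d : V) (w : ℂ) (x : V) :
    HasDerivAt (fun w => expChar a t d w x) (expChar a t d w x * ⟪x, d⟫) w := by
  unfold expChar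
  have h : HasDerivAt (fun w : ℂ => (⟪x, a⟫ : ℂ) + ⟪x, t⟫ * Complex.I + w * ⟪x, d⟫)
      (⟪x, d⟫ : ℂ) w := by
    simpa using ((hasDerivAt_id w).mul_const (⟪x, d⟫ : ℂ)).const_add
      ((⟪x, a⟫ : ℂ) + ⟪x, t⟫ * Complex.I)
  exact h.cexp

lemma continuous_expChar (a t d : V) (w : ℂ) : Continuous (expChar a t d w) := by
  unfold expChar
  fun_prop

variable [MeasurableSpace V] [BorelSpace V]

lemma integrable_expChar {p : Measure V} {a t d : V} {w : ℂ}
    (h : Integrable (fun x => Real.exp ⟪x, a + w.re • d⟫) p) :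
    Integrable (expChar a t d w) p := by
  rw [← integrable_norm_iff (continuous_expChar a t d w).aestronglyMeasurable]
  simpa only [norm_expChar] using h

lemma differentiableAt_integral_expChar {p : Measure V} {a d : V} (t : V) {r : ℝ}
    (hp : ∀ c ∈ Metric.ball a r, Integrable (fun x => Real.exp ⟪x, c⟫) p)
    {w : ℂ} (hw : |w.re| * ‖d‖ < r) :
    DifferentiableAt ℂ (fun w => ∫ x, expChar a t d w x ∂p) w := by
  obtain ⟨δ, hδ, hδr⟩ : ∃ δ > 0, (|w.re| + 2 * δ) * ‖d‖ < r := by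
    refine ⟨(r - |w.re| * ‖d‖) / (4 * (‖d‖ + 1)), by
      have : 0 < r - |w.re| * ‖d‖ := by linarith
      positivity, ?_⟩
    have h1 : 0 < ‖d‖ + 1 := by positivity
    have h2 : (r - |w.re| * ‖d‖) / (4 * (‖d‖ + 1)) * (‖d‖ + 1) = (r - |w.re| * ‖d‖) / 4 := by
      field_simp
    have h3 : 0 ≤ (r - |w.re| * ‖d‖) / (4 * (‖d‖ + 1)) :=
      div_nonneg (by linarith) (by positivity)
    nlinarith [norm_nonneg d]
  have hball : ∀ s : ℝ, |s| ≤ |w.re| + 2 * δ → a + s • d ∈ Metric.ball a r := by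
    intro s hs
    rw [mem_ball_iff_norm, add_sub_cancel_left, norm_smul, Real.norm_eq_abs]
    exact (mul_le_mul_of_nonneg_right hs (norm_nonneg d)).trans_lt hδr
  have hint : ∀ s : ℝ, |s| ≤ |w.re| + 2 * δ → Integrable (fun x => Real.exp ⟪x, a + s • d⟫) p :=
    fun s hs => hp _ (hball s hs)
  have habs : ∀ e : ℝ, |e| ≤ 2 * δ → |w.re + e| ≤ |w.re| + 2 * δ := fun e he =>
    (abs_add_le _ _).trans (by linarith)
  refine (hasDerivAt_integral_of_dominated_loc_of_deriv_le
    (F' := fun w x => expChar a t d w x * ⟪x, d⟫)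
    (bound := fun x => (Real.exp ⟪x, a + (w.re + 2 * δ) • d⟫
      + Real.exp ⟪x, a + (w.re - 2 * δ) • d⟫) / δ)
    (Metric.ball_mem_nhds w hδ) (.of_forall fun z =>
      (continuous_expChar a t d z).aestronglyMeasurable)
    (integrable_expChar (hint _ (by linarith))) ?_ ?_ ?_ ?_).2.differentiableAt
  · exact ((continuous_expChar a t d w).mul (by fun_prop)).aestronglyMeasurable
  · refine .of_forall fun x z hz => ?_
    rw [norm_mul, norm_expChar, Complex.norm_real, Real.norm_eq_abs]
    have hz' : |z.re - w.re| < δ := by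
      rw [mem_ball_iff_norm] at hz
      exact (Complex.abs_re_le_norm (z - w)).trans_lt hz
    rw [abs_lt] at hz'
    simp only [inner_add_right, inner_smul_right]
    set A := ⟪x, a⟫
    set Y := ⟪x, d⟫
    rw [le_div_iff₀ hδ, mul_assoc]
    have h1 : |Y| * δ ≤ Real.exp (δ * |Y|) := by
      have := Real.add_one_le_exp (δ * |Y|)
      linarith
    calc Real.exp (A + z.re * Y) * (|Y| * δ)
        ≤ Real.exp (A + z.re * Y) * Real.exp (δ * |Y|) := by gcongr
      _ = Real.exp (A + z.re * Y + δ * |Y|) := (Real.exp_add _ _).symm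
      _ ≤ _ := by
        rcases le_total 0 Y with hY | hY
        · rw [abs_of_nonneg hY]
          exact (Real.exp_le_exp.2 (by nlinarith)).trans
            (le_add_of_nonneg_right (Real.exp_pos _).le)
        · rw [abs_of_nonpos hY]
          exact (Real.exp_le_exp.2 (by nlinarith)).trans
            (le_add_of_nonneg_left (Real.exp_pos _).le)
  · exact ((hint _ (habs _ (abs_of_pos (by linarith : 0 < 2 * δ)).le)).add
      (hint _ (habs (-(2 * δ)) (by rw [abs_neg, abs_of_pos (by linarith)])))).div_const δ
  · exact .of_forall fun x z _ => hasDerivAt_expChar a t d z x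

variable [SecondCountableTopology V]

/-- Measures with finite exponential moments at `a` are determined by their Fourier-Laplace
transform on the vertical slice over `a`. -/
lemma measure_ext_of_integral_expChar [CompleteSpace V] {p q : Measure V} {a : V}
    (hp : Integrable (fun x => Real.exp ⟪x, a⟫) p)
    (hq : Integrable (fun x => Real.exp ⟪x, a⟫) q)
    (h : ∀ t : V, ∫ x, expChar a t 0 0 x ∂p = ∫ x, expChar a t 0 0 x ∂q) : p = q := by
  set g : V → ℝ≥0∞ := fun x => ENNReal.ofReal (Real.exp ⟪x, a⟫) with hg
  have hgm : Measurable g := by fun_prop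
  have hfin : ∀ m : Measure V, Integrable (fun x => Real.exp ⟪x, a⟫) m →
      IsFiniteMeasure (m.withDensity g) := fun m hm =>
    isFiniteMeasure_withDensity_ofReal hm.2
  have hchar : ∀ (m : Measure V) (t : V),
      charFun (m.withDensity g) t = ∫ x, expChar a t 0 0 x ∂m := by
    intro m t
    rw [charFun_apply, integral_withDensity_eq_integral_toReal_smul hgm (by simp [hg])]
    refine integral_congr_ae (.of_forall fun x => ?_)
    simp [hg, expChar, ENNReal.toReal_ofReal (Real.exp_pos _).le, Complex.exp_add]
  have key : p.withDensity g = q.withDensity g := by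
    have := hfin p hp
    have := hfin q hq
    refine Measure.ext_of_charFun (funext fun t => ?_)
    rw [hchar, hchar, h]
  have hinv : ∀ m : Measure V, (m.withDensity g).withDensity g⁻¹ = m := fun m =>
    withDensity_inv_same hgm (.of_forall fun x => by simp [hg, Real.exp_pos])
      (.of_forall fun x => by simp [hg])
  rw [← hinv p, key, hinv q]

lemma integral_expChar_conv {p q : Measure V} [SFinite p] [SFinite q] (a t d : V) (w : ℂ) :
    ∫ x, expChar a t d w x ∂(p ∗ q)
      = (∫ x, expChar a t d w x ∂p) * ∫ x, expChar a t d w x ∂q := by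
  rw [Measure.conv, integral_map (by fun_prop) (continuous_expChar a t d w).aestronglyMeasurable,
    ← integral_prod_mul]
  simp only [expChar_add]

lemma integrable_expChar_conv {p q : Measure V} [SFinite p] [SFinite q] {a t d : V} {w : ℂ}
    (hp : Integrable (expChar a t d w) p) (hq : Integrable (expChar a t d w) q) :
    Integrable (expChar a t d w) (p ∗ q) := by
  rw [Measure.conv, integrable_map_measure (continuous_expChar a t d w).aestronglyMeasurable
    (by fun_prop)]
  refine (hp.mul_prod hq).congr (.of_forall fun z => ?_)
  simp [expChar_add]

/-- Convolution of differences of measures with exponential moments has no zero divisors. -/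
theorem eq_or_eq_of_conv_add_conv_eq [CompleteSpace V] {p q p' q' : Measure V}
    [SFinite p] [SFinite q] [SFinite p'] [SFinite q'] {a : V} {r : ℝ} (hr : 0 < r)
    (hp : ∀ c ∈ Metric.ball a r, Integrable (fun x => Real.exp ⟪x, c⟫) p)
    (hq : ∀ c ∈ Metric.ball a r, Integrable (fun x => Real.exp ⟪x, c⟫) q)
    (hp' : ∀ c ∈ Metric.ball a r, Integrable (fun x => Real.exp ⟪x, c⟫) p')
    (hq' : ∀ c ∈ Metric.ball a r, Integrable (fun x => Real.exp ⟪x, c⟫) q')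
    (h : p ∗ p' + q ∗ q' = p ∗ q' + q ∗ p') : p = q ∨ p' = q' := by
  by_contra! hne
  have ha : a ∈ Metric.ball a r := Metric.mem_ball_self hr
  obtain ⟨t, ht⟩ : ∃ t, ∫ x, expChar a t 0 0 x ∂p ≠ ∫ x, expChar a t 0 0 x ∂q := by
    by_contra! h'
    exact hne.1 (measure_ext_of_integral_expChar (hp a ha) (hq a ha) h')
  obtain ⟨t', ht'⟩ : ∃ t, ∫ x, expChar a t 0 0 x ∂p' ≠ ∫ x, expChar a t 0 0 x ∂q' := by
    by_contra! h'
    exact hne.2 (measure_ext_of_integral_expChar (hp' a ha) (hq' a ha) h')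
  set d := t' - t
  let U : Set ℂ := {w | |w.re| * ‖d‖ < r}
  have hUo : IsOpen U := isOpen_lt (by fun_prop) continuous_const
  have hUc : IsPreconnected U := by
    have : U = Complex.reLm ⁻¹' {s : ℝ | |s| * ‖d‖ < r} := rfl
    rw [this]
    refine (Convex.linear_preimage ?_ Complex.reLm).isPreconnected
    have hconv : ConvexOn ℝ Set.univ fun s : ℝ => |s| * ‖d‖ := by
      have := (convexOn_norm (E := ℝ) convex_univ).smul (norm_nonneg d)
      simpa [mul_comm] using this
    simpa only [Set.mem_univ, true_and] using hconv.convex_lt r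
  have hmem : ∀ w ∈ U, a + w.re • d ∈ Metric.ball a r := by
    intro w hw
    rw [mem_ball_iff_norm, add_sub_cancel_left, norm_smul, Real.norm_eq_abs]
    exact hw
  have han : ∀ {m m' : Measure V},
      (∀ c ∈ Metric.ball a r, Integrable (fun x => Real.exp ⟪x, c⟫) m) →
      (∀ c ∈ Metric.ball a r, Integrable (fun x => Real.exp ⟪x, c⟫) m') →
      AnalyticOnNhd ℂ (fun w => ∫ x, expChar a t d w x ∂m - ∫ x, expChar a t d w x ∂m') U :=
    fun hm hm' => DifferentiableOn.analyticOnNhd (fun w hw =>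
      ((differentiableAt_integral_expChar t hm hw).sub
        (differentiableAt_integral_expChar t hm' hw)).differentiableWithinAt) hUo
  have hmul : ∀ w ∈ U, (∫ x, expChar a t d w x ∂p - ∫ x, expChar a t d w x ∂q)
      * (∫ x, expChar a t d w x ∂p' - ∫ x, expChar a t d w x ∂q') = 0 := by
    intro w hw
    have i : ∀ {m : Measure V},
        (∀ c ∈ Metric.ball a r, Integrable (fun x => Real.exp ⟪x, c⟫) m) →
        Integrable (expChar a t d w) m := fun hm => integrable_expChar (hm _ (hmem w hw))
    have hI := congrArg (fun m => ∫ x, expChar a t d w x ∂m) h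
    rw [integral_add_measure (integrable_expChar_conv (i hp) (i hp'))
        (integrable_expChar_conv (i hq) (i hq')),
      integral_add_measure (integrable_expChar_conv (i hp) (i hq'))
        (integrable_expChar_conv (i hq) (i hp'))] at hI
    simp only [integral_expChar_conv] at hI
    linear_combination hI
  have e0 : expChar a t d 0 = expChar a t 0 0 := by
    ext x
    simp [expChar]
  have e1 : expChar a t d Complex.I = expChar a t' 0 0 := by
    ext x
    simp only [expChar, d, inner_sub_right, inner_zero_right]
    congr 1
    push_cast
    ring
  rcases (han hp hq).eq_zero_or_eq_zero_of_mul_eq_zero (han hp' hq') hmul hUc with h0 | h0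
  · have := h0 0 (by simpa [U] using hr)
    rw [e0] at this
    exact ht (sub_eq_zero.1 this)
  · have := h0 Complex.I (by simpa [U] using hr)
    rw [e1] at this
    exact ht' (sub_eq_zero.1 this)

end Laplace

/-- Coordinatewise logarithm of the absolute value. -/
def logMap {n : ℕ} (x : Fin n → ℝ) : EuclideanSpace ℝ (Fin n) :=
  WithLp.toLp 2 fun i => Real.log (x i)

lemma measurable_logMap {n : ℕ} : Measurable (logMap (n := n)) := by
  unfold logMap
  fun_prop

lemma mem_setA_univ {n : ℕ} {x : Fin n → ℝ} :
    x ∈ setA (Finset.univ : Finset (Fin n)) ↔ ∀ i, x i ≠ 0 := by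
  simp [setA]

lemma measurable_flipE {n : ℕ} (E : Finset (Fin n)) : Measurable (flipE E) := by
  refine measurable_pi_lambda _ fun i => ?_
  unfold flipE
  split_ifs <;> fun_prop

lemma flipE_flipE {n : ℕ} (E F : Finset (Fin n)) (x : Fin n → ℝ) :
    flipE E (flipE F x) = flipE (E ∆ F) x := by
  ext i
  by_cases hE : i ∈ E <;> by_cases hF : i ∈ F <;> simp [flipE, Finset.mem_symmDiff, hE, hF]

lemma flipE_exp_logMap {n : ℕ} {x : Fin n → ℝ} (hx : ∀ i, x i ≠ 0) :
    flipE (Finset.univ.filter fun i => x i < 0) (fun i => Real.exp (logMap x i)) = x := by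
  ext i
  simp only [flipE, logMap, Finset.mem_filter, Finset.mem_univ, true_and, Real.exp_log_eq_abs (hx i)]
  split_ifs with h
  · rw [abs_of_neg h, neg_neg]
  · rw [abs_of_nonneg (not_lt.1 h)]

lemma map_logMap_mconvPos {n : ℕ} {ρ σ : Measure (Fin n → ℝ)} [SFinite ρ] [SFinite σ]
    (hρ : ∀ᵐ x ∂ρ, ∀ i, x i ≠ 0) (hσ : ∀ᵐ x ∂σ, ∀ i, x i ≠ 0) :
    (mconvPos ρ σ).map logMap = (ρ.map logMap) ∗ (σ.map logMap) := by
  rw [mconvPos, Measure.map_map measurable_logMap (by fun_prop), Measure.conv,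
    Measure.map_prod_map _ _ measurable_logMap measurable_logMap,
    Measure.map_map (by fun_prop) (measurable_logMap.prodMap measurable_logMap)]
  refine Measure.map_congr ?_
  filter_upwards [Measure.quasiMeasurePreserving_fst.ae hρ,
    Measure.quasiMeasurePreserving_snd.ae hσ] with p h1 h2
  ext i
  simp [logMap, Real.log_mul (h1 i) (h2 i)]

instance {n : ℕ} (ρ σ : Measure (Fin n → ℝ)) [IsFiniteMeasure ρ] [IsFiniteMeasure σ] :
    IsFiniteMeasure (mconvPos ρ σ) := by
  unfold mconvPos
  infer_instance

lemma toSigned_sub_eq_zero_iff {X : Type*} [MeasurableSpace X] (ρ σ : Measure X)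
    [IsFiniteMeasure ρ] [IsFiniteMeasure σ] : toSigned ρ - toSigned σ = 0 ↔ ρ = σ := by
  rw [sub_eq_zero, toSigned, toSigned, dif_pos ‹_›, dif_pos ‹_›,
    Measure.toSignedMeasure_eq_toSignedMeasure_iff]

/-- An unconditional signed measure off the coordinate hyperplanes is determined by the images of
its Jordan parts under the coordinatewise logarithm. -/
lemma eq_zero_of_map_logMap_eq {n : ℕ} {μ : SM n} (hu : ∀ E : Finset (Fin n), Tmap E μ = μ)
    (hc : ConcOn μ (setA (Finset.univ : Finset (Fin n))))
    (h : μ.toJordanDecomposition.posPart.map logMap = μ.toJordanDecomposition.negPart.map logMap) :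
    μ = 0 := by
  ext B hB
  set P := μ.toJordanDecomposition.posPart
  set N := μ.toJordanDecomposition.negPart
  have hpres : ∀ E : Finset (Fin n), MeasurableSet (flipE E ⁻¹' B) := fun E =>
    measurable_flipE E hB
  have hae : ∀ᵐ x ∂(P + N), ∀ i, x i ≠ 0 := by
    refine Filter.mem_of_superset (mem_ae_iff.2 hc) fun x hx => mem_setA_univ.1 hx
  rw [ae_add_measure_iff] at hae
  let e : EuclideanSpace ℝ (Fin n) → (Fin n → ℝ) := fun y i => Real.exp (y i)
  have he : Measurable e := by fun_prop
  let H : (Fin n → ℝ) → ℝ≥0∞ := fun x => ∑ E : Finset (Fin n), B.indicator 1 (flipE E x)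
  have hind : ∀ E : Finset (Fin n), Measurable fun x =>
      B.indicator (1 : (Fin n → ℝ) → ℝ≥0∞) (flipE E x) :=
    fun E => (measurable_one.indicator hB).comp (measurable_flipE E)
  have hH : Measurable H := Finset.measurable_fun_sum _ fun E _ => hind E
  have hflip : ∀ x : Fin n → ℝ, ∀ F, H (flipE F x) = H x := by
    intro x F
    simp only [H, flipE_flipE]
    exact Fintype.sum_equiv (Equiv.ofBijective (· ∆ F) (symmDiff_left_involutive F).bijective)
      _ _ fun E => rfl
  have hsum : ∀ m : Measure (Fin n → ℝ), (∀ᵐ x ∂m, ∀ i, x i ≠ 0) →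
      ∑ E : Finset (Fin n), m (flipE E ⁻¹' B) = ∫⁻ y, H (e y) ∂(m.map logMap) := by
    intro m hm
    rw [lintegral_map (show Measurable fun y => H (e y) from hH.comp he) measurable_logMap]
    calc ∑ E : Finset (Fin n), m (flipE E ⁻¹' B) = ∫⁻ x, H x ∂m := by
          rw [lintegral_finsetSum _ fun E _ => hind E]
          refine Finset.sum_congr rfl fun E _ => ?_
          rw [← lintegral_indicator_one (hpres E)]
          rfl
      _ = _ := by
          refine lintegral_congr_ae (hm.mono fun x hx => ?_)
          conv_lhs => rw [← flipE_exp_logMap hx, hflip]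
  have hPN : ∑ E : Finset (Fin n), P (flipE E ⁻¹' B) = ∑ E : Finset (Fin n), N (flipE E ⁻¹' B) := by
    rw [hsum P hae.1, hsum N hae.2, h]
  have hval : ∀ C, MeasurableSet C → μ C = (P C).toReal - (N C).toReal := by
    intro C hC
    conv_lhs => rw [← μ.toSignedMeasure_toJordanDecomposition]
    rw [JordanDecomposition.toSignedMeasure, Measure.toSignedMeasure_sub_apply hC]
    rfl
  have hE : ∀ E : Finset (Fin n), μ (flipE E ⁻¹' B) = μ B := by
    intro E
    conv_rhs => rw [← hu E]
    rw [Tmap, VectorMeasure.map_apply _ (measurable_flipE E) hB]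
  have hzero : ∑ E : Finset (Fin n), μ (flipE E ⁻¹' B) = 0 := by
    simp only [hval _ (hpres _), Finset.sum_sub_distrib]
    rw [← ENNReal.toReal_sum (by simp), ← ENNReal.toReal_sum (by simp), hPN, sub_self]
  simpa [hE] using hzero

lemma exp_inner_logMap_le {n : ℕ} {x : Fin n → ℝ} (hx : ∀ i, x i ≠ 0)
    {c : EuclideanSpace ℝ (Fin n)} (hc0 : ∀ i, 0 ≤ c i) (hc1 : ∑ i, c i ≤ 1) :
    Real.exp (inner ℝ (logMap x) c) ≤ 1 + e2 x := by
  have he : 0 ≤ e2 x := Real.sqrt_nonneg _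
  rw [← Real.le_log_iff_exp_le (by linarith), PiLp.inner_apply]
  have hlog : 0 ≤ Real.log (1 + e2 x) := Real.log_nonneg (by linarith)
  have hle : ∀ i, Real.log (x i) ≤ Real.log (1 + e2 x) := by
    intro i
    rw [← Real.log_abs]
    refine Real.log_le_log (abs_pos.2 (hx i)) ?_
    have : |x i| ≤ e2 x := Real.abs_le_sqrt
      (Finset.single_le_sum (f := fun i => x i ^ 2) (fun i _ => sq_nonneg _) (Finset.mem_univ i))
    linarith
  calc ∑ i, inner ℝ (logMap x i) (c i) ≤ ∑ i, c i * Real.log (1 + e2 x) := by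
        refine Finset.sum_le_sum fun i _ => ?_
        simpa [logMap] using mul_le_mul_of_nonneg_left (hle i) (hc0 i)
    _ = (∑ i, c i) * Real.log (1 + e2 x) := by rw [Finset.sum_mul]
    _ ≤ _ := by nlinarith

lemma integrable_exp_inner_map_logMap {n : ℕ} {ρ : Measure (Fin n → ℝ)} [IsFiniteMeasure ρ]
    (hae : ∀ᵐ x ∂ρ, ∀ i, x i ≠ 0) (hi : ∫⁻ x, ENNReal.ofReal (e2 x) ∂ρ < ⊤)
    {c : EuclideanSpace ℝ (Fin n)} (hc0 : ∀ i, 0 ≤ c i) (hc1 : ∑ i, c i ≤ 1) :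
    Integrable (fun y => Real.exp (inner ℝ y c)) (ρ.map logMap) := by
  rw [integrable_map_measure (by fun_prop) measurable_logMap.aemeasurable]
  have hm : Measurable (e2 (n := n)) := by
    unfold e2
    fun_prop
  have he : Integrable e2 ρ := by
    refine ⟨hm.aestronglyMeasurable, ?_⟩
    rwa [hasFiniteIntegral_iff_ofReal (f := e2) (.of_forall fun x => Real.sqrt_nonneg _)]
  refine ((integrable_const 1).add he).mono' ?_ (hae.mono fun x hx => ?_)
  · have : Continuous fun y : EuclideanSpace ℝ (Fin n) => Real.exp (inner ℝ y c) := by fun_prop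
    exact (this.measurable.comp measurable_logMap).aestronglyMeasurable
  · simpa using exp_inner_logMap_le hx hc0 hc1

lemma mem_ball_const_bounds {n : ℕ} (hn : 1 ≤ n) {c : EuclideanSpace ℝ (Fin n)}
    (hc : c ∈ Metric.ball (WithLp.toLp 2 fun _ => 1 / (2 * n : ℝ)) (1 / (2 * n : ℝ))) :
    (∀ i, 0 ≤ c i) ∧ ∑ i, c i ≤ 1 := by
  have hn' : (0 : ℝ) < n := by exact_mod_cast hn
  have h : ∀ i, |c i - 1 / (2 * n : ℝ)| < 1 / (2 * n : ℝ) := fun i => by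
    rw [mem_ball_iff_norm] at hc
    exact (PiLp.norm_apply_le (c - WithLp.toLp 2 fun _ => 1 / (2 * n : ℝ)) i).trans_lt hc
  refine ⟨fun i => by linarith [(abs_lt.1 (h i)).1], ?_⟩
  calc ∑ i, c i ≤ ∑ _i : Fin n, 1 / (n : ℝ) := by
        refine Finset.sum_le_sum fun i _ => ?_
        have h2 : 1 / (n : ℝ) = 1 / (2 * n) + 1 / (2 * n) := by
          field_simp
          norm_num
        linarith [(abs_lt.1 (h i)).2]
    _ = 1 := by
        simp [hn'.ne']

/-- Theorem: for integrable unconditional `μ, ν` concentrated on `A_{[n]}`,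
`μ ⊛ ν ≠ 0` iff `μ ≠ 0` and `ν ≠ 0`. -/
theorem stmt12 {n : ℕ} (hn : 1 ≤ n) (μ ν : SM n)
    (hμi : IntegrableSM μ) (hνi : IntegrableSM ν)
    (hμu : ∀ E : Finset (Fin n), Tmap E μ = μ) (hνu : ∀ E : Finset (Fin n), Tmap E ν = ν)
    (hμc : ConcOn μ (setA (Finset.univ : Finset (Fin n))))
    (hνc : ConcOn ν (setA (Finset.univ : Finset (Fin n)))) :
    mconv μ ν ≠ 0 ↔ μ ≠ 0 ∧ ν ≠ 0 := by
  have hparts : ∀ {ξ : SM n}, IntegrableSM ξ → ConcOn ξ (setA (Finset.univ : Finset (Fin n))) →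
      ((∀ᵐ x ∂ξ.toJordanDecomposition.posPart, ∀ i, x i ≠ 0) ∧
        ∀ᵐ x ∂ξ.toJordanDecomposition.negPart, ∀ i, x i ≠ 0) ∧
      ∫⁻ x, ENNReal.ofReal (e2 x) ∂ξ.toJordanDecomposition.posPart < ⊤ ∧
      ∫⁻ x, ENNReal.ofReal (e2 x) ∂ξ.toJordanDecomposition.negPart < ⊤ := by
    intro ξ hi hc
    rw [IntegrableSM, SignedMeasure.totalVariation, lintegral_add_measure, ENNReal.add_lt_top] at hi
    refine ⟨?_, hi⟩
    rw [← ae_add_measure_iff]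
    exact Filter.mem_of_superset (mem_ae_iff.2 hc) fun x hx => mem_setA_univ.1 hx
  obtain ⟨⟨hμp, hμn⟩, hμpi, hμni⟩ := hparts hμi hμc
  obtain ⟨⟨hνp, hνn⟩, hνpi, hνni⟩ := hparts hνi hνc
  refine ⟨fun h => ⟨?_, ?_⟩, fun ⟨hμ, hν⟩ h => ?_⟩
  · rintro rfl
    exact h (by simp [mconv, mconvPos, SignedMeasure.toJordanDecomposition_zero])
  · rintro rfl
    exact h (by simp [mconv, mconvPos, SignedMeasure.toJordanDecomposition_zero])
  · rw [mconv, toSigned_sub_eq_zero_iff] at h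
    have hlog := congrArg (fun m => m.map logMap) h
    simp only [Measure.map_add _ _ measurable_logMap, map_logMap_mconvPos hμp hνp,
      map_logMap_mconvPos hμp hνn, map_logMap_mconvPos hμn hνp,
      map_logMap_mconvPos hμn hνn] at hlog
    have hint : ∀ {ρ : Measure (Fin n → ℝ)} [IsFiniteMeasure ρ], (∀ᵐ x ∂ρ, ∀ i, x i ≠ 0) →
        ∫⁻ x, ENNReal.ofReal (e2 x) ∂ρ < ⊤ →
        ∀ c ∈ Metric.ball (WithLp.toLp 2 fun _ : Fin n => 1 / (2 * n : ℝ)) (1 / (2 * n : ℝ)),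
          Integrable (fun y => Real.exp (inner ℝ y c)) (ρ.map logMap) := fun hae hi c hc =>
      integrable_exp_inner_map_logMap hae hi (mem_ball_const_bounds hn hc).1
        (mem_ball_const_bounds hn hc).2
    have hr : 0 < 1 / (2 * n : ℝ) := by positivity
    rcases eq_or_eq_of_conv_add_conv_eq hr (hint hμp hμpi) (hint hμn hμni) (hint hνp hνpi)
      (hint hνn hνni) hlog with h' | h'
    · exact hμ (eq_zero_of_map_logMap_eq hμu hμc h')
    · exact hν (eq_zero_of_map_logMap_eq hνu hνc h')

end
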